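/- Let K be a Markov kernel on a measurable space (E, ℰ) with invariant probability measure π satisfying the Doeblin condition K(x,·) ≥ ε κ(·) for all x ∈ E, with ε ∈ (0,1) and κ a probability measure. Let f : E → ℝ be bounded measurable, let ĥ(x) = Σ_{i=0}^∞ [K^i(f)(x) − π(f)], and let (X_i) be the Markov chain with kernel K started at x_1 ∈ E. Then for every p ≥ 1 there exists a finite constant B(p,ε), depending only on p and ε, such that for every N ≥ 2, E_{x_1}[ | Σ_{i=1}^{N−1} [ĥ(X_{i+1}) − K(ĥ)(X_i)] |^p ]^{1/p} ≤ B(p,ε) √N ‖f‖. -/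

import Mathlib

open MeasureTheory ProbabilityTheory
open scoped ENNReal NNReal

/-- Iterates of a Markov kernel: `kpow K 0 = id`, `kpow K (n+1) = K ∘ₖ kpow K n`. -/
noncomputable def kpow {E : Type*} [MeasurableSpace E] (K : Kernel E E) : ℕ → Kernel E E :=
  fun n => Nat.rec Kernel.id (fun _ ih => K.comp ih) n

/-- The σ-algebra on `Ω` generated by `X 0, …, X i` (natural filtration of the process). -/
def natSigma {Ω E : Type*} [MeasurableSpace E] (X : ℕ → Ω → E) (i : ℕ) :
    MeasurableSpace Ω :=
  ⨆ (j : ℕ) (_ : j ≤ i), MeasurableSpace.comap (X j) inferInstance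

theorem integral_exp_sum_le {Ω : Type*} [MeasurableSpace Ω] (μ : Measure Ω)
    [IsProbabilityMeasure μ] (d : ℕ → Ω → ℝ) {D : ℝ} (hD : 0 < D) (hd : ∀ i, Measurable (d i))
    (hb : ∀ i ω, |d i ω| ≤ D)
    (h0 : ∀ (i : ℕ) (t : ℝ), ∫ ω, Real.exp (t * ∑ j ∈ Finset.range i, d j ω) * d i ω ∂μ = 0)
    (t : ℝ) (n : ℕ) :
    Integrable (fun ω => Real.exp (t * ∑ j ∈ Finset.range n, d j ω)) μ ∧
    ∫ ω, Real.exp (t * ∑ j ∈ Finset.range n, d j ω) ∂μ ≤ Real.exp (n * ((t * D) ^ 2 / 2)) := by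
  have hint : ∀ n : ℕ, Integrable (fun ω => Real.exp (t * ∑ j ∈ Finset.range n, d j ω)) μ := by
    intro n
    refine Integrable.of_bound (C := Real.exp (|t| * (n * D)))
      (Measurable.aestronglyMeasurable (by fun_prop)) (ae_of_all _ fun ω => ?_)
    rw [Real.norm_eq_abs, Real.abs_exp, Real.exp_le_exp]
    refine (le_abs_self _).trans ?_
    rw [abs_mul]
    gcongr
    refine (Finset.abs_sum_le_sum_abs _ _).trans ?_
    simpa using Finset.sum_le_card_nsmul (Finset.range n) (fun j => |d j ω|) D fun j _ => hb j ω
  refine ⟨hint n, ?_⟩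
  induction n with
  | zero => simp
  | succ n ih =>
    have hi2 : Integrable (fun ω => Real.exp (t * ∑ j ∈ Finset.range n, d j ω) * d n ω) μ :=
      (hint n).mul_bdd (c := D) (hd n).aestronglyMeasurable (ae_of_all _ fun ω => hb n ω)
    have key : ∀ ω, Real.exp (t * ∑ j ∈ Finset.range (n + 1), d j ω) ≤
        Real.cosh (t * D) * Real.exp (t * ∑ j ∈ Finset.range n, d j ω) +
        Real.sinh (t * D) / D * (Real.exp (t * ∑ j ∈ Finset.range n, d j ω) * d n ω) := by
      intro ω
      rw [Finset.sum_range_succ, mul_add, Real.exp_add]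
      have h1 : |d n ω / D| ≤ 1 := by
        rw [abs_div, abs_of_pos hD, div_le_one hD]
        exact hb n ω
      have h2 := Real.exp_mul_le_cosh_add_mul_sinh h1 (t * D)
      have h3 : d n ω / D * (t * D) = t * d n ω := by field_simp
      rw [h3] at h2
      calc _ ≤ Real.exp (t * ∑ j ∈ Finset.range n, d j ω) *
            (Real.cosh (t * D) + d n ω / D * Real.sinh (t * D)) := by gcongr
        _ = _ := by ring
    calc ∫ ω, Real.exp (t * ∑ j ∈ Finset.range (n + 1), d j ω) ∂μ
        ≤ ∫ ω, (Real.cosh (t * D) * Real.exp (t * ∑ j ∈ Finset.range n, d j ω) +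
          Real.sinh (t * D) / D * (Real.exp (t * ∑ j ∈ Finset.range n, d j ω) * d n ω)) ∂μ :=
          integral_mono (hint _) (((hint n).const_mul _).add (hi2.const_mul _)) key
      _ = Real.cosh (t * D) * ∫ ω, Real.exp (t * ∑ j ∈ Finset.range n, d j ω) ∂μ := by
          rw [integral_add ((hint n).const_mul _) (hi2.const_mul _), integral_const_mul,
            integral_const_mul, h0, mul_zero, add_zero]
      _ ≤ Real.exp ((t * D) ^ 2 / 2) * Real.exp (n * ((t * D) ^ 2 / 2)) := by
          gcongr
          exact Real.cosh_le_exp_half_sq _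
      _ = _ := by
          rw [← Real.exp_add]
          push_cast
          ring_nf

theorem abs_rpow_le_exp_add_exp_neg {p : ℝ} (hp : 0 ≤ p) (u : ℝ) :
    |u| ^ p ≤ 1 + (Nat.factorial ⌈p⌉₊ : ℝ) * (Real.exp u + Real.exp (-u)) := by
  have hk : (0 : ℝ) < Nat.factorial ⌈p⌉₊ := by positivity
  have hE : Real.exp |u| ≤ Real.exp u + Real.exp (-u) := by
    rcases abs_choice u with h | h <;> rw [h] <;> linarith [Real.exp_pos u, Real.exp_pos (-u)]
  rcases le_total |u| 1 with h | h
  · have := Real.rpow_le_one (abs_nonneg u) h hp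
    have : 0 ≤ (Nat.factorial ⌈p⌉₊ : ℝ) * (Real.exp u + Real.exp (-u)) := by positivity
    linarith
  · have h1 : |u| ^ p ≤ |u| ^ ⌈p⌉₊ := by
      rw [← Real.rpow_natCast]
      exact Real.rpow_le_rpow_of_exponent_le h (Nat.le_ceil p)
    have h2 := Real.pow_div_factorial_le_exp _ (abs_nonneg u) ⌈p⌉₊
    rw [div_le_iff₀ hk] at h2
    have h3 := mul_le_mul_of_nonneg_left hE hk.le
    linarith

theorem rpow_integral_abs_sum_le {Ω : Type*} [MeasurableSpace Ω] (μ : Measure Ω)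
    [IsProbabilityMeasure μ] (d : ℕ → Ω → ℝ) {D : ℝ} (hD : 0 < D) (hd : ∀ i, Measurable (d i))
    (hb : ∀ i ω, |d i ω| ≤ D)
    (h0 : ∀ (i : ℕ) (t : ℝ), ∫ ω, Real.exp (t * ∑ j ∈ Finset.range i, d j ω) * d i ω ∂μ = 0)
    {p : ℝ} (hp : 1 ≤ p) {n N : ℕ} (hN : 0 < N) (hn : n ≤ N) :
    (∫ ω, |∑ j ∈ Finset.range n, d j ω| ^ p ∂μ) ^ (1 / p) ≤
      (1 + (Nat.factorial ⌈p⌉₊ : ℝ) * (2 * Real.exp (1 / 2))) ^ (1 / p) * Real.sqrt N * D := by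
  have hp0 : 0 < p := by linarith
  have hN' : (0 : ℝ) < N := by exact_mod_cast hN
  have hs : 0 < Real.sqrt N := Real.sqrt_pos.2 hN'
  set A := D * Real.sqrt N with hA
  have hA0 : 0 < A := by positivity
  have hexp : ∀ t : ℝ, t ^ 2 = (A⁻¹) ^ 2 → (n : ℝ) * ((t * D) ^ 2 / 2) ≤ 1 / 2 := by
    intro t ht
    have hsq : Real.sqrt N ^ 2 = N := Real.sq_sqrt hN'.le
    have hnN : (n : ℝ) ≤ N := by exact_mod_cast hn
    rw [mul_pow, ht, hA, inv_pow, mul_pow, hsq]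
    have : (n : ℝ) * (((D ^ 2 * N)⁻¹ * D ^ 2) / 2) = (n / N) / 2 := by field_simp
    rw [this]
    have := (div_le_one hN').2 hnN
    linarith
  obtain ⟨i1, e1⟩ := integral_exp_sum_le μ d hD hd hb h0 A⁻¹ n
  obtain ⟨i2, e2⟩ := integral_exp_sum_le μ d hD hd hb h0 (-A⁻¹) n
  replace e1 := e1.trans (Real.exp_le_exp.2 (hexp _ rfl))
  replace e2 := e2.trans (Real.exp_le_exp.2 (hexp _ (by ring)))
  set F := (Nat.factorial ⌈p⌉₊ : ℝ)
  have hF : 0 ≤ F := by positivity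
  have hM : 0 ≤ 1 + F * (2 * Real.exp (1 / 2)) := by positivity
  have hpt : ∀ ω, |∑ j ∈ Finset.range n, d j ω| ^ p ≤
      A ^ p * (1 + F * (Real.exp (A⁻¹ * ∑ j ∈ Finset.range n, d j ω) +
        Real.exp (-A⁻¹ * ∑ j ∈ Finset.range n, d j ω))) := by
    intro ω
    have h := abs_rpow_le_exp_add_exp_neg hp0.le (A⁻¹ * ∑ j ∈ Finset.range n, d j ω)
    rw [← neg_mul] at h
    refine le_trans (le_of_eq ?_) (mul_le_mul_of_nonneg_left h (by positivity))
    rw [← Real.mul_rpow hA0.le (abs_nonneg _), abs_mul, abs_of_pos (inv_pos.2 hA0),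
      mul_inv_cancel_left₀ hA0.ne']
  have hI : ∫ ω, |∑ j ∈ Finset.range n, d j ω| ^ p ∂μ ≤
      A ^ p * (1 + F * (2 * Real.exp (1 / 2))) := by
    refine (integral_mono_of_nonneg (ae_of_all _ fun ω => by positivity)
      (((integrable_const 1).add ((i1.add i2).const_mul F)).const_mul _)
      (ae_of_all _ hpt)).trans ?_
    rw [integral_const_mul]
    gcongr
    have hadd : ∫ ω, (1 + F * (Real.exp (A⁻¹ * ∑ j ∈ Finset.range n, d j ω) +
        Real.exp (-A⁻¹ * ∑ j ∈ Finset.range n, d j ω))) ∂μ =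
        1 + F * ((∫ ω, Real.exp (A⁻¹ * ∑ j ∈ Finset.range n, d j ω) ∂μ) +
          ∫ ω, Real.exp (-A⁻¹ * ∑ j ∈ Finset.range n, d j ω) ∂μ) := by
      have hc := integral_add (μ := μ) (integrable_const (1 : ℝ)) ((i1.add i2).const_mul F)
      have hc2 := integral_add i1 i2
      simp only [Pi.add_apply] at hc hc2
      rw [hc, integral_const_mul, hc2]
      simp
    refine hadd.trans_le ?_
    gcongr
    linarith
  calc _ ≤ (A ^ p * (1 + F * (2 * Real.exp (1 / 2)))) ^ (1 / p) := by
        refine Real.rpow_le_rpow (integral_nonneg fun ω => by positivity) hI (by positivity)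
    _ = _ := by
        rw [Real.mul_rpow (by positivity) hM, ← Real.rpow_mul hA0.le, mul_one_div_cancel hp0.ne',
          Real.rpow_one, hA]
        ring

theorem Measurable.integrable_of_mem_Icc {E : Type*} [MeasurableSpace E] {f : E → ℝ}
    (hf : Measurable f) {m M : ℝ} (hm : ∀ x, f x ∈ Set.Icc m M) (ν : Measure E)
    [IsFiniteMeasure ν] : Integrable f ν :=
  Integrable.of_mem_Icc m M hf.aemeasurable (ae_of_all _ hm)

theorem mul_integral_le_integral_of_smul_le {E : Type*} [MeasurableSpace E] {κ ν : Measure E}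
    {ε : ℝ} (hε : 0 ≤ ε) (h : ENNReal.ofReal ε • κ ≤ ν) {g : E → ℝ} (hg : ∀ x, 0 ≤ g x)
    (hi : Integrable g ν) : ε * ∫ x, g x ∂κ ≤ ∫ x, g x ∂ν := by
  have := integral_mono_measure h (ae_of_all _ hg) hi
  rwa [integral_smul_measure, ENNReal.toReal_ofReal hε, smul_eq_mul] at this

theorem integral_mem_Icc_of_doeblin {E : Type*} [MeasurableSpace E] {κ ν : Measure E}
    [IsProbabilityMeasure κ] [IsProbabilityMeasure ν] {ε : ℝ} (hε : 0 ≤ ε)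
    (h : ENNReal.ofReal ε • κ ≤ ν) {f : E → ℝ} (hf : Measurable f) {m M : ℝ}
    (hm : ∀ x, f x ∈ Set.Icc m M) :
    ∫ x, f x ∂ν ∈
      Set.Icc (m + ε * (∫ x, f x ∂κ - m)) (M - ε * (M - ∫ x, f x ∂κ)) := by
  have iκ := hf.integrable_of_mem_Icc hm κ
  have iν := hf.integrable_of_mem_Icc hm ν
  have h1 := mul_integral_le_integral_of_smul_le hε h (fun x => sub_nonneg.2 (hm x).1)
    (iν.sub (integrable_const m))
  have h2 := mul_integral_le_integral_of_smul_le hε h (fun x => sub_nonneg.2 (hm x).2)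
    ((integrable_const M).sub iν)
  rw [integral_sub iκ (integrable_const m), integral_sub iν (integrable_const m)] at h1
  rw [integral_sub (integrable_const M) iκ, integral_sub (integrable_const M) iν] at h2
  simp only [integral_const, probReal_univ, smul_eq_mul, one_mul] at h1 h2
  constructor <;> linarith

instance isMarkovKernel_kpow {E : Type*} [MeasurableSpace E] (K : Kernel E E) [IsMarkovKernel K]
    (n : ℕ) : IsMarkovKernel (kpow K n) := by
  induction n with
  | zero => exact inferInstanceAs (IsMarkovKernel (Kernel.id (α := E)))
  | succ n ih => exact inferInstanceAs (IsMarkovKernel (K ∘ₖ kpow K n))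

theorem integral_integral_of_bind_eq {E : Type*} [MeasurableSpace E] {K : Kernel E E}
    {π : Measure E} (hπ : π.bind (fun x => K x) = π) {f : E → ℝ} (hf : Integrable f π) :
    ∫ x, ∫ y, f y ∂(K x) ∂π = ∫ y, f y ∂π := by
  have h : (K ∘ₖ Kernel.const Unit π) () = π := by
    rw [Kernel.comp_apply, Kernel.const_apply]
    exact hπ
  have := Kernel.integral_comp (η := K) (κ := Kernel.const Unit π) (a := ()) (f := f)
    (by rwa [h])
  rw [h, Kernel.const_apply] at this
  exact this.symm

theorem abs_integral_kpow_sub_le {E : Type*} [MeasurableSpace E] {K : Kernel E E}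
    [IsMarkovKernel K] {π : Measure E} [IsProbabilityMeasure π]
    (hπ : π.bind (fun x => K x) = π) {κ : Measure E} [IsProbabilityMeasure κ] {ε : ℝ}
    (hε : 0 ≤ ε) (hK : ∀ x : E, ENNReal.ofReal ε • κ ≤ K x) (n : ℕ) (x : E) {f : E → ℝ}
    (hf : Measurable f) {m M : ℝ} (hm : ∀ x, f x ∈ Set.Icc m M) :
    |∫ y, f y ∂(kpow K n x) - ∫ y, f y ∂π| ≤ (1 - ε) ^ n * (M - m) := by
  induction n generalizing f m M with
  | zero =>
    have h1 : ∫ y, f y ∂(kpow K 0 x) = f x := by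
      change ∫ y, f y ∂(Kernel.id x) = f x
      rw [Kernel.id_apply, integral_dirac' _ _ hf.stronglyMeasurable]
    have h2 : ∫ y, f y ∂π ≤ ∫ _, M ∂π :=
      integral_mono (hf.integrable_of_mem_Icc hm π) (integrable_const M) fun y => (hm y).2
    have h3 : ∫ _, m ∂π ≤ ∫ y, f y ∂π :=
      integral_mono (integrable_const m) (hf.integrable_of_mem_Icc hm π) fun y => (hm y).1
    simp only [integral_const, probReal_univ, smul_eq_mul, one_mul] at h2 h3
    rw [h1, pow_zero, one_mul, abs_le]
    constructor <;> linarith [(hm x).1, (hm x).2]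
  | succ n ih =>
    have h1 : ∫ y, f y ∂(kpow K (n + 1) x) = ∫ z, ∫ y, f y ∂(K z) ∂(kpow K n x) :=
      Kernel.integral_comp (hf.integrable_of_mem_Icc hm (kpow K (n + 1) x))
    rw [h1, ← integral_integral_of_bind_eq hπ (hf.integrable_of_mem_Icc hm π)]
    refine (ih (f := fun z => ∫ y, f y ∂(K z)) hf.stronglyMeasurable.integral_kernel.measurable
      fun z => integral_mem_Icc_of_doeblin hε (hK z) hf hm).trans (le_of_eq ?_)
    ring

theorem abs_tsum_integral_kpow_sub_le {E : Type*} [MeasurableSpace E] {K : Kernel E E}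
    [IsMarkovKernel K] {π : Measure E} [IsProbabilityMeasure π]
    (hπ : π.bind (fun x => K x) = π) {κ : Measure E} [IsProbabilityMeasure κ] {ε : ℝ}
    (hε : ε ∈ Set.Ioo (0 : ℝ) 1) (hK : ∀ x : E, ENNReal.ofReal ε • κ ≤ K x) (x : E) {f : E → ℝ}
    (hf : Measurable f) {C : ℝ} (hC : ∀ x, |f x| ≤ C) :
    |∑' j : ℕ, (∫ y, f y ∂(kpow K j x) - ∫ y, f y ∂π)| ≤ 2 * C / ε := by
  have hg := (hasSum_geometric_of_lt_one (r := 1 - ε) (by linarith [hε.2])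
    (by linarith [hε.1])).mul_right (C - -C)
  rw [← Real.norm_eq_abs]
  refine (tsum_of_norm_bounded hg fun j => (Real.norm_eq_abs _).trans_le <| abs_integral_kpow_sub_le hπ
    hε.1.le hK j x hf fun x => abs_le.1 (hC x)).trans (le_of_eq ?_)
  rw [sub_sub_cancel]
  ring

theorem measurable_tsum_integral_kpow_sub {E : Type*} [MeasurableSpace E] (K : Kernel E E)
    (π : Measure E) {f : E → ℝ} (hf : Measurable f) :
    Measurable fun x => ∑' j : ℕ, (∫ y, f y ∂(kpow K j x) - ∫ y, f y ∂π) :=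
  Measurable.tsum fun j =>
    (hf.stronglyMeasurable.integral_kernel (κ := kpow K j)).measurable.sub_const _

theorem measurable_natSigma {Ω E : Type*} [MeasurableSpace E] (X : ℕ → Ω → E) {i j : ℕ}
    (h : j ≤ i) : Measurable[natSigma X i] (X j) :=
  (comap_measurable (X j)).mono (le_iSup₂_of_le j h le_rfl) le_rfl

/-- Under the Doeblin minorization condition with constant `ε`, for every `p ≥ 1` there is a
constant `B(p,ε)` depending only on `p` and `ε` such that, with `ĥ` the solution
`ĥ(x) = ∑_{i≥0} [K^i(f)(x) - π(f)]` of the Poisson equation, the martingale part of the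
telescoping decomposition satisfies
`E_{x₁}[ |∑_{i=1}^{N-1} (ĥ(X_{i+1}) - K(ĥ)(X_i))|^p ]^{1/p} ≤ B(p,ε) √N ‖f‖`. -/
theorem doeblin_martingale_lp_bound (ε : ℝ) (hε : ε ∈ Set.Ioo (0 : ℝ) 1) (p : ℝ) (hp : 1 ≤ p) :
    ∃ B : ℝ,
      ∀ (E : Type*) [MeasurableSpace E] (K : Kernel E E) [IsMarkovKernel K]
        (π : Measure E) [IsProbabilityMeasure π], π.bind (fun x => K x) = π →
      ∀ (κ : Measure E) [IsProbabilityMeasure κ], (∀ x : E, ENNReal.ofReal ε • κ ≤ K x) →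
      ∀ (f : E → ℝ), Measurable f → ∀ C : ℝ, (∀ x, |f x| ≤ C) →
      ∀ (x₁ : E) (Ω : Type*) [MeasurableSpace Ω] (μ : Measure Ω) [IsProbabilityMeasure μ]
        (X : ℕ → Ω → E),
        X 0 = (fun _ => x₁) →
        (∀ i, Measurable (X i)) →
        -- Markov property: conditionally on `X 0, …, X i`, `X (i+1)` has law `K (X i, ·)`.
        (∀ (i : ℕ) (φ : E → ℝ), Measurable φ → (∃ Cφ, ∀ y, |φ y| ≤ Cφ) →
          ∀ (H : Ω → ℝ), Measurable[natSigma X i] H → (∃ CH, ∀ ω, |H ω| ≤ CH) →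
          ∫ ω, H ω * φ (X (i + 1) ω) ∂μ = ∫ ω, H ω * ∫ y, φ y ∂(K (X i ω)) ∂μ) →
      ∀ N : ℕ, 2 ≤ N →
        (∫ ω,
            |∑ i ∈ Finset.range (N - 1),
                ((∑' j : ℕ, (∫ y, f y ∂(kpow K j (X (i + 1) ω)) - ∫ y, f y ∂π)) -
                  ∫ z, (∑' j : ℕ, (∫ y, f y ∂(kpow K j z) - ∫ y, f y ∂π)) ∂(K (X i ω)))| ^ p
          ∂μ) ^ (1 / p)
          ≤ B * Real.sqrt N * C := by
  have hε0 := hε.1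
  refine ⟨(1 + (Nat.factorial ⌈p⌉₊ : ℝ) * (2 * Real.exp (1 / 2))) ^ (1 / p) * (4 / ε), ?_⟩
  intro E _ K _ π _ hπ κ _ hK f hf C hC x₁ Ω _ μ _ X _ hX hMarkov N hN
  set h : E → ℝ := fun x => ∑' j : ℕ, (∫ y, f y ∂(kpow K j x) - ∫ y, f y ∂π) with hh
  have hmeas : Measurable h := measurable_tsum_integral_kpow_sub K π hf
  have hKmeas : Measurable fun x => ∫ z, h z ∂(K x) :=
    hmeas.stronglyMeasurable.integral_kernel.measurable
  -- It suffices to prove the bound for every constant exceeding C, since it is then positive.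
  have key : ∀ C' > C, (∫ ω, |∑ i ∈ Finset.range (N - 1),
      (h (X (i + 1) ω) - ∫ z, h z ∂(K (X i ω)))| ^ p ∂μ) ^ (1 / p) ≤
      (1 + (Nat.factorial ⌈p⌉₊ : ℝ) * (2 * Real.exp (1 / 2))) ^ (1 / p) * (4 / ε) *
        Real.sqrt N * C' := by
    intro C' hC'
    have hC0 : 0 < C' := ((abs_nonneg _).trans (hC x₁)).trans_lt hC'
    have hbd : ∀ x, |h x| ≤ 2 * C' / ε := fun x =>
      abs_tsum_integral_kpow_sub_le hπ hε hK x hf fun y => (hC y).trans hC'.le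
    have hKbd : ∀ x, |∫ z, h z ∂(K x)| ≤ 2 * C' / ε := fun x => by
      simpa using norm_integral_le_of_norm_le_const (μ := K x)
        (ae_of_all _ fun z => (Real.norm_eq_abs (h z)).trans_le (hbd z))
    set d : ℕ → Ω → ℝ := fun i ω => h (X (i + 1) ω) - ∫ z, h z ∂(K (X i ω)) with hd
    have hdm : ∀ i, Measurable (d i) := fun i =>
      (hmeas.comp (hX (i + 1))).sub (hKmeas.comp (hX i))
    have hdb : ∀ i ω, |d i ω| ≤ 4 * C' / ε := fun i ω =>
      ((abs_sub _ _).trans (add_le_add (hbd _) (hKbd _))).trans (le_of_eq (by ring))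
    have h0 : ∀ (i : ℕ) (t : ℝ),
        ∫ ω, Real.exp (t * ∑ j ∈ Finset.range i, d j ω) * d i ω ∂μ = 0 := by
      intro i t
      have hHb : ∀ ω, |Real.exp (t * ∑ j ∈ Finset.range i, d j ω)| ≤
          Real.exp (|t| * (i * (4 * C' / ε))) := by
        intro ω
        rw [Real.abs_exp, Real.exp_le_exp]
        refine (le_abs_self _).trans ?_
        rw [abs_mul]
        gcongr
        refine (Finset.abs_sum_le_sum_abs _ _).trans ?_
        simpa using Finset.sum_le_card_nsmul (Finset.range i) (fun j => |d j ω|) _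
          fun j _ => hdb j ω
      have hHm : Measurable[natSigma X i]
          fun ω => Real.exp (t * ∑ j ∈ Finset.range i, d j ω) := by
        refine Real.measurable_exp.comp (Measurable.const_mul
          (Finset.measurable_fun_sum _ fun j hj => ?_) t)
        have hj' := Finset.mem_range.1 hj
        exact (hmeas.comp (measurable_natSigma X (by omega))).sub
          (hKmeas.comp (measurable_natSigma X (by omega)))
      have hHi : Integrable (fun ω => Real.exp (t * ∑ j ∈ Finset.range i, d j ω)) μ :=
        Integrable.of_bound (Measurable.aestronglyMeasurable (by fun_prop)) _ (ae_of_all _ hHb)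
      have hM := hMarkov i h hmeas ⟨_, hbd⟩ _ hHm ⟨_, hHb⟩
      simp only [hd, mul_sub] at hM hHi ⊢
      rw [integral_sub, hM, sub_self]
      · exact hHi.mul_bdd (hmeas.comp (hX (i + 1))).aestronglyMeasurable
          (ae_of_all _ fun ω => hbd _)
      · exact hHi.mul_bdd (hKmeas.comp (hX i)).aestronglyMeasurable
          (ae_of_all _ fun ω => hKbd _)
    refine (rpow_integral_abs_sum_le μ d (D := 4 * C' / ε) (by positivity) hdm hdb h0 hp
      (by omega : 0 < N) (Nat.sub_le N 1)).trans (le_of_eq ?_)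
    ring
  exact ge_of_tendsto (((continuous_const_mul _).tendsto C).mono_left
    (nhdsWithin_le_nhds (s := Set.Ioi C))) (Filter.eventually_of_mem self_mem_nhdsWithin key)
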